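/- For every λ₀ ∈ Λ and every ε > 0 there exists λ ∈ Λ with |λ − λ₀| ≤ ε such that the polynomial P_λ has a wandering disc contained in its filled Julia set which is not attracted to an attracting cycle: there exists a closed ball D ⊆ ℂ_p such that (1) D ⊆ K(P_λ) := {z ∈ ℂ_p : the sequence {P_λ^n(z)}_{n≥0} is bounded}; (2) the images P_λ^n(D), n ≥ 0, are pairwise disjoint; and (3) for every k ≥ 1 and every periodic point z₀ with P_λ^k(z₀) = z₀ and |(P_λ^k)'(z₀)| < 1, no point x ∈ D satisfies min_{0≤j<k} |P_λ^n(x) − P_λ^j(z₀)| → 0 as n → ∞. -/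

import Mathlib

open Filter Metric

/-- The polynomial family `P_λ(z) = (λ/p)·z^p + (1 − λ/p)·z^{p+1}`. -/
noncomputable def Pfam {K : Type*} [NontriviallyNormedField K] (p : ℕ) (lam z : K) : K :=
  lam / (p : K) * z ^ p + (1 - lam / (p : K)) * z ^ (p + 1)

section UltrametricField

variable {K : Type*} [NontriviallyNormedField K] [IsUltrametricDist K]

theorem norm_add_eq_left_of_norm_lt {a b : K} (h : ‖b‖ < ‖a‖) : ‖a + b‖ = ‖a‖ := by
  rw [IsUltrametricDist.norm_add_eq_max_of_norm_ne_norm h.ne', max_eq_left h.le]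

theorem norm_eq_of_norm_sub_lt {a b : K} (h : ‖b - a‖ < ‖a‖) : ‖b‖ = ‖a‖ := by
  have := norm_add_eq_left_of_norm_lt h
  rwa [add_sub_cancel] at this

theorem norm_sub_one_eq_one {z : K} (h : ‖z‖ < 1) : ‖z - 1‖ = 1 := by
  have : ‖(-1 : K) + z‖ = ‖(-1 : K)‖ := norm_add_eq_left_of_norm_lt (by simpa using h)
  rw [neg_add_eq_sub] at this
  simpa using this

theorem norm_sub_one_of_one_lt {z : K} (h : 1 < ‖z‖) : ‖z - 1‖ = ‖z‖ := by
  rw [sub_eq_add_neg]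
  exact norm_add_eq_left_of_norm_lt (by simpa using h)

theorem norm_sub_le_of_norm_sub_le {a b c : K} {r : ℝ} (h₁ : ‖a - c‖ ≤ r) (h₂ : ‖b - c‖ ≤ r) :
    ‖a - b‖ ≤ r := by
  have := IsUltrametricDist.norm_add_le_max (a - c) (c - b)
  rw [sub_add_sub_cancel, norm_sub_rev c b] at this
  exact this.trans (max_le h₁ h₂)

theorem norm_pow_succ_sub_pow_succ_le {x y : K} {ρ : ℝ} (hx : ‖x‖ ≤ ρ) (hy : ‖y‖ ≤ ρ) (m : ℕ) :
    ‖x ^ (m + 1) - y ^ (m + 1)‖ ≤ ρ ^ m * ‖x - y‖ := by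
  have hρ : 0 ≤ ρ := (norm_nonneg x).trans hx
  rw [← geom_sum₂_mul, norm_mul]
  refine mul_le_mul_of_nonneg_right ?_ (norm_nonneg _)
  refine IsUltrametricDist.norm_sum_le_of_forall_le_of_nonneg (by positivity) fun i hi => ?_
  have hi : i ≤ m := by simpa [Nat.lt_succ_iff] using hi
  rw [norm_mul, norm_pow, norm_pow]
  calc ‖x‖ ^ i * ‖y‖ ^ (m + 1 - 1 - i) ≤ ρ ^ i * ρ ^ (m + 1 - 1 - i) := by gcongr
    _ = ρ ^ m := by rw [← pow_add]; congr 1; omega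

theorem norm_pow_prime_sub_pow_prime_le {p : ℕ} (hp : p.Prime) {x y : K} {ρ t : ℝ}
    (hx : ‖x‖ ≤ ρ) (hy : ‖y‖ ≤ ρ) (hxy : ‖x - y‖ ≤ ρ * t) (ht₀ : 0 ≤ t)
    (ht : t ≤ ‖(p : K)‖) :
    ‖x ^ p - y ^ p‖ ≤ ‖(p : K)‖ * ρ ^ p * t := by
  have hρ : 0 ≤ ρ := (norm_nonneg x).trans hx
  have hp2 := hp.two_le
  have hq1 : ‖(p : K)‖ ≤ 1 := IsUltrametricDist.norm_natCast_le_one K p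
  have hu : ‖x - y‖ ≤ ρ := norm_sub_le_of_norm_sub_le (c := 0) (by simpa) (by simpa)
  have key := add_pow_prime_eq hp (x - y) y
  rw [sub_add_cancel] at key
  have : x ^ p - y ^ p = (x - y) ^ p + (p : K) * (x - y) * y *
      ∑ k ∈ Finset.Ioo 0 p, (x - y) ^ (k - 1) * y ^ (p - k - 1) * ((p.choose k / p : ℕ) : K) := by
    rw [key]; ring
  rw [this]
  refine (IsUltrametricDist.norm_add_le_max _ _).trans (max_le ?_ ?_)
  · rw [norm_pow]
    calc ‖x - y‖ ^ p ≤ (ρ * t) ^ p := by gcongr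
      _ = ρ ^ p * (t ^ (p - 1) * t) := by
        rw [mul_pow, ← pow_succ, Nat.sub_add_cancel (by omega)]
      _ ≤ ρ ^ p * (‖(p : K)‖ * t) := by
        gcongr
        calc t ^ (p - 1) ≤ ‖(p : K)‖ ^ (p - 1) := by gcongr
          _ ≤ ‖(p : K)‖ ^ 1 := pow_le_pow_of_le_one (norm_nonneg _) hq1 (by omega)
          _ = _ := pow_one _
      _ = _ := by ring
  · have hS : ‖∑ k ∈ Finset.Ioo 0 p,
        (x - y) ^ (k - 1) * y ^ (p - k - 1) * ((p.choose k / p : ℕ) : K)‖ ≤ ρ ^ (p - 2) := by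
      refine IsUltrametricDist.norm_sum_le_of_forall_le_of_nonneg (by positivity) fun k hk => ?_
      rw [Finset.mem_Ioo] at hk
      rw [norm_mul, norm_mul, norm_pow, norm_pow]
      calc ‖x - y‖ ^ (k - 1) * ‖y‖ ^ (p - k - 1) * ‖((p.choose k / p : ℕ) : K)‖
          ≤ ρ ^ (k - 1) * ρ ^ (p - k - 1) * 1 := by
            gcongr
            exact IsUltrametricDist.norm_natCast_le_one K _
        _ = ρ ^ (p - 2) := by rw [mul_one, ← pow_add]; congr 1; omega
    rw [norm_mul, norm_mul, norm_mul]
    calc _ ≤ ‖(p : K)‖ * (ρ * t) * ρ * ρ ^ (p - 2) := by gcongr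
      _ = ‖(p : K)‖ * (ρ ^ (p - 2) * ρ ^ 2) * t := by ring
      _ = _ := by rw [← pow_add, Nat.sub_add_cancel hp2]

open Polynomial in
/-- A polynomial over an algebraically closed ultrametric field whose absolute value takes
different values at `a` and `u` has a root in the ball about `a` of radius `‖u - a‖`. -/
theorem Polynomial.exists_root_norm_sub_le [IsAlgClosed K] (f : K[X]) {a u : K}
    (h : ‖f.eval u‖ ≠ ‖f.eval a‖) : ∃ w, f.eval w = 0 ∧ ‖w - a‖ ≤ ‖u - a‖ := by
  by_contra! hc
  apply h
  have hf : f ≠ 0 := by rintro rfl; simp at h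
  have norm_eval (x : K) : ‖f.eval x‖ =
      ‖f.leadingCoeff‖ * (f.roots.map fun w => ‖x - w‖).prod := by
    rw [(IsAlgClosed.splits f).eval_eq_prod_roots, norm_mul]
    congr 1
    simpa [Multiset.map_map, Function.comp_def] using
      map_multiset_prod (normHom : K →*₀ ℝ) (f.roots.map fun w => x - w)
  rw [norm_eval, norm_eval]
  congr 2
  refine Multiset.map_congr rfl fun w hw => ?_
  have hw' := hc w ((mem_roots hf).1 hw)
  apply norm_eq_of_norm_sub_lt
  rw [sub_sub_sub_cancel_right, norm_sub_rev a w]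
  exact hw'

end UltrametricField

section Family

variable {K : Type*} [NontriviallyNormedField K] {p : ℕ}

theorem Pfam_sub_Pfam_eq (l l' z z' : K) :
    Pfam p l z - Pfam p l' z' =
      (Pfam p l z - Pfam p l z') + (l - l') / (p : K) * z' ^ p * (1 - z') := by
  simp only [Pfam]; ring

theorem Pfam_one (l : K) : Pfam p l 1 = 1 := by simp [Pfam]

theorem Pfam_zero (hp : p.Prime) (l : K) : Pfam p l 0 = 0 := by simp [Pfam, hp.ne_zero]

theorem hasDerivAt_Pfam_one (hpK : (p : K) ≠ 0) (l : K) :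
    HasDerivAt (Pfam p l) ((p : K) + 1 - l / p) 1 := by
  have h := ((hasDerivAt_pow p (1 : K)).const_mul (l / (p : K))).add
    ((hasDerivAt_pow (p + 1) (1 : K)).const_mul (1 - l / (p : K)))
  refine h.congr_deriv ?_
  push_cast
  field_simp
  simp
  ring

open Polynomial in
theorem exists_polynomial_eval_eq_iterate_Pfam (x : K) (n : ℕ) :
    ∃ f : K[X], ∀ l, f.eval l = (Pfam p l)^[n] x := by
  induction n with
  | zero => exact ⟨C x, fun l => by simp⟩
  | succ n ih =>
    obtain ⟨f, hf⟩ := ih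
    refine ⟨C (p : K)⁻¹ * X * f ^ p + (1 - C (p : K)⁻¹ * X) * f ^ (p + 1), fun l => ?_⟩
    rw [Function.iterate_succ_apply', ← hf]
    simp [Pfam]
    ring

variable [IsUltrametricDist K]

/-- If `λ ↦ P_λ^n(x) - c` takes values of different size at `a` and `u`, then it vanishes at a
parameter no further from `a` than `u` is. -/
theorem exists_param_iterate_Pfam_eq [IsAlgClosed K] (x c : K) (n : ℕ) {a u : K}
    (h : ‖(Pfam p u)^[n] x - c‖ ≠ ‖(Pfam p a)^[n] x - c‖) :
    ∃ w, (Pfam p w)^[n] x = c ∧ ‖w - a‖ ≤ ‖u - a‖ := by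
  obtain ⟨f, hf⟩ := exists_polynomial_eval_eq_iterate_Pfam (p := p) x n
  obtain ⟨w, hw, hwa⟩ := (f - Polynomial.C c).exists_root_norm_sub_le (a := a) (u := u)
    (by simpa [hf] using h)
  exact ⟨w, by simpa [hf, sub_eq_zero] using hw, hwa⟩

theorem exists_Pfam_eq [IsAlgClosed K] (l c : K) {a u : K}
    (h : ‖Pfam p l u - c‖ ≠ ‖Pfam p l a - c‖) :
    ∃ w, Pfam p l w = c ∧ ‖w - a‖ ≤ ‖u - a‖ := by
  have hf (z : K) : (Polynomial.C (l / (p : K)) * Polynomial.X ^ p +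
      Polynomial.C (1 - l / (p : K)) * Polynomial.X ^ (p + 1) - Polynomial.C c).eval z =
      Pfam p l z - c := by simp [Pfam]
  obtain ⟨w, hw, hwa⟩ := Polynomial.exists_root_norm_sub_le _ (a := a) (u := u)
    (by rw [hf, hf]; exact h)
  exact ⟨w, by rwa [hf, sub_eq_zero] at hw, hwa⟩

theorem norm_div_natCast (hpnorm : ‖(p : K)‖ = (p : ℝ)⁻¹) {l : K} (hl : ‖l - 1‖ < 1) :
    ‖l / (p : K)‖ = p := by
  have : ‖l‖ = 1 := by
    rw [norm_eq_of_norm_sub_lt (a := 1) (by simpa using hl), norm_one]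
  rw [norm_div, this, hpnorm, one_div, inv_inv]

theorem norm_one_sub_div_natCast (hp : p.Prime) (hpnorm : ‖(p : K)‖ = (p : ℝ)⁻¹) {l : K}
    (hl : ‖l - 1‖ < 1) : ‖1 - l / (p : K)‖ = p := by
  have h := norm_div_natCast hpnorm hl
  rw [norm_sub_rev, norm_sub_one_of_one_lt, h]
  rw [h]
  exact_mod_cast hp.one_lt

theorem norm_Pfam_sub_Pfam_near_one (hp : p.Prime) (hpnorm : ‖(p : K)‖ = (p : ℝ)⁻¹) {l z z' : K}
    (hl : ‖l - 1‖ < 1) (hz : ‖z - 1‖ < 1) (hz' : ‖z' - 1‖ < 1) :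
    ‖Pfam p l z - Pfam p l z'‖ = p * ‖z - z'‖ := by
  rcases eq_or_ne z z' with rfl | hne
  · simp
  have hd : 0 < ‖z - z'‖ := norm_pos_iff.2 (sub_ne_zero.2 hne)
  have hP : (1 : ℝ) < p := by exact_mod_cast hp.one_lt
  have h1 : ‖z‖ = 1 := by rw [norm_eq_of_norm_sub_lt (a := 1) (by simpa using hz), norm_one]
  have h1' : ‖z'‖ = 1 := by rw [norm_eq_of_norm_sub_lt (a := 1) (by simpa using hz'), norm_one]
  have hlp := norm_div_natCast hpnorm hl
  have hpow (m : ℕ) : ‖z ^ (m + 1) - z' ^ (m + 1)‖ ≤ ‖z - z'‖ := by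
    simpa using norm_pow_succ_sub_pow_succ_le h1.le h1'.le m
  have key : Pfam p l z - Pfam p l z' = -(l / (p : K) * z' ^ p * (z - z')) +
      ((z ^ (p + 1) - z' ^ (p + 1)) + l / (p : K) * (z ^ p - z' ^ p) * (1 - z)) := by
    simp only [Pfam]; ring
  have hmain : ‖-(l / (p : K) * z' ^ p * (z - z'))‖ = p * ‖z - z'‖ := by
    rw [norm_neg, norm_mul, norm_mul, norm_pow, h1', hlp, one_pow, mul_one]
  rw [key, norm_add_eq_left_of_norm_lt, hmain]
  rw [hmain]
  refine (IsUltrametricDist.norm_add_le_max _ _).trans_lt (max_lt ?_ ?_)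
  · exact (hpow p).trans_lt (by nlinarith)
  · have := hpow (p - 1)
    rw [Nat.sub_add_cancel hp.one_le] at this
    rw [norm_mul, norm_mul, hlp, norm_sub_rev 1 z]
    calc (p : ℝ) * ‖z ^ p - z' ^ p‖ * ‖z - 1‖ ≤ p * ‖z - z'‖ * ‖z - 1‖ := by gcongr
      _ < p * ‖z - z'‖ * 1 := by gcongr
      _ = _ := mul_one _

theorem norm_Pfam_sub_one (hp : p.Prime) (hpnorm : ‖(p : K)‖ = (p : ℝ)⁻¹) {l z : K}
    (hl : ‖l - 1‖ < 1) (hz : ‖z - 1‖ < 1) : ‖Pfam p l z - 1‖ = p * ‖z - 1‖ := by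
  simpa [Pfam_one] using norm_Pfam_sub_Pfam_near_one hp hpnorm hl hz (z' := 1) (by simp)

theorem norm_Pfam_of_norm_lt_one (hp : p.Prime) (hpnorm : ‖(p : K)‖ = (p : ℝ)⁻¹) {l z : K}
    (hl : ‖l - 1‖ < 1) (hz : ‖z‖ < 1) : ‖Pfam p l z‖ = p * ‖z‖ ^ p := by
  rcases eq_or_ne z 0 with rfl | hne
  · simp [Pfam_zero hp, hp.ne_zero]
  have hP : (0 : ℝ) < p := by exact_mod_cast hp.pos
  have h0 : 0 < ‖z‖ := norm_pos_iff.2 hne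
  have hmain : ‖l / (p : K) * z ^ p‖ = p * ‖z‖ ^ p := by
    rw [norm_mul, norm_pow, norm_div_natCast hpnorm hl]
  rw [Pfam, norm_add_eq_left_of_norm_lt, hmain]
  rw [hmain, norm_mul, norm_one_sub_div_natCast hp hpnorm hl, norm_pow, pow_succ]
  have : 0 < (p : ℝ) * ‖z‖ ^ p := by positivity
  nlinarith

theorem norm_Pfam_sub_Pfam_le_of_le (hp : p.Prime) (hpnorm : ‖(p : K)‖ = (p : ℝ)⁻¹) {l z z' : K}
    {ρ t β : ℝ} (hl : ‖l - 1‖ < 1) (hz : ‖z‖ ≤ ρ) (hz' : ‖z'‖ ≤ ρ) (ht₀ : 0 ≤ t)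
    (ht : t ≤ (p : ℝ)⁻¹) (hzz' : ‖z - z'‖ ≤ ρ * t) (hρ : ρ ≤ β) (hβ : (p : ℝ)⁻¹ ≤ β) :
    ‖Pfam p l z - Pfam p l z'‖ ≤ p * ρ ^ p * (β * t) := by
  have hP : (0 : ℝ) < p := by exact_mod_cast hp.pos
  have hρ₀ : 0 ≤ ρ := (norm_nonneg z).trans hz
  have key : Pfam p l z - Pfam p l z' = l / (p : K) * (z ^ p - z' ^ p) +
      (1 - l / (p : K)) * (z ^ (p + 1) - z' ^ (p + 1)) := by simp only [Pfam]; ring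
  rw [key]
  refine (IsUltrametricDist.norm_add_le_max _ _).trans (max_le ?_ ?_)
  · rw [norm_mul, norm_div_natCast hpnorm hl]
    have := norm_pow_prime_sub_pow_prime_le hp hz hz' hzz' ht₀ (by rwa [hpnorm])
    rw [hpnorm] at this
    calc (p : ℝ) * ‖z ^ p - z' ^ p‖ ≤ p * ((p : ℝ)⁻¹ * ρ ^ p * t) := by gcongr
      _ ≤ p * (β * ρ ^ p * t) := by gcongr
      _ = _ := by ring
  · rw [norm_mul, norm_one_sub_div_natCast hp hpnorm hl]
    calc (p : ℝ) * ‖z ^ (p + 1) - z' ^ (p + 1)‖ ≤ p * (ρ ^ p * (ρ * t)) := by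
          gcongr
          exact (norm_pow_succ_sub_pow_succ_le hz hz' p).trans (by gcongr)
      _ ≤ p * (ρ ^ p * (β * t)) := by gcongr
      _ = _ := by ring

theorem norm_Pfam_sub_Pfam_near_zero (hp : p.Prime) (hpnorm : ‖(p : K)‖ = (p : ℝ)⁻¹)
    {l l' z z' : K} {ρ t β : ℝ} (hl : ‖l - 1‖ < 1) (hz : ‖z‖ = ρ) (hz' : ‖z'‖ = ρ)
    (hρ₀ : 0 < ρ) (hρ₁ : ρ < 1) (ht₀ : 0 ≤ t) (ht : t ≤ (p : ℝ)⁻¹) (hzz' : ‖z - z'‖ ≤ ρ * t)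
    (hρ : ρ ≤ β) (hβ : (p : ℝ)⁻¹ ≤ β) :
    ‖Pfam p l z - Pfam p l' z'‖ ≤ p * ρ ^ p * max (β * t) ‖l - l'‖ ∧
      (β * t < ‖l - l'‖ → ‖Pfam p l z - Pfam p l' z'‖ = p * ρ ^ p * ‖l - l'‖) := by
  have hP : (0 : ℝ) < p := by exact_mod_cast hp.pos
  have h1 := norm_Pfam_sub_Pfam_le_of_le hp hpnorm hl hz.le hz'.le ht₀ ht hzz' hρ hβ
  have h2 : ‖(l - l') / (p : K) * z' ^ p * (1 - z')‖ = p * ρ ^ p * ‖l - l'‖ := by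
    rw [norm_mul, norm_mul, norm_div, hpnorm, norm_pow, hz', norm_sub_rev 1 z',
      norm_sub_one_eq_one (hz'.trans_lt hρ₁)]
    field_simp
  rw [Pfam_sub_Pfam_eq]
  constructor
  · refine (IsUltrametricDist.norm_add_le_max _ _).trans (max_le ?_ ?_)
    · exact h1.trans (by gcongr; exact le_max_left _ _)
    · exact h2.le.trans (by gcongr; exact le_max_right _ _)
  · intro hlt
    rw [add_comm, norm_add_eq_left_of_norm_lt, h2]
    rw [h2]
    exact h1.trans_lt (by gcongr)

theorem norm_iterate_Pfam_sub_one (hp : p.Prime) (hpnorm : ‖(p : K)‖ = (p : ℝ)⁻¹) {l z : K}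
    (hl : ‖l - 1‖ < 1) {m : ℕ} (hz : (p : ℝ) ^ m * ‖z - 1‖ < p) {j : ℕ} (hj : j ≤ m) :
    ‖(Pfam p l)^[j] z - 1‖ = (p : ℝ) ^ j * ‖z - 1‖ := by
  have hP : (1 : ℝ) < p := by exact_mod_cast hp.one_lt
  induction j with
  | zero => simp
  | succ j ih =>
    have ih := ih (by omega)
    have hlt : (p : ℝ) ^ j * ‖z - 1‖ < 1 := by
      have : (p : ℝ) ^ (j + 1) * ‖z - 1‖ < p :=
        lt_of_le_of_lt (by gcongr; exact hP.le) hz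
      rw [pow_succ] at this
      nlinarith
    rw [Function.iterate_succ_apply', norm_Pfam_sub_one hp hpnorm hl (ih.trans_lt hlt), ih]
    ring

theorem norm_iterate_Pfam_sub_iterate_Pfam_near_one (hp : p.Prime)
    (hpnorm : ‖(p : K)‖ = (p : ℝ)⁻¹) {l l' z z' : K} (hl : ‖l - 1‖ < 1) (hl' : ‖l' - 1‖ < 1)
    {m : ℕ} (hz : (p : ℝ) ^ m * ‖z - 1‖ < p) (hz' : (p : ℝ) ^ m * ‖z' - 1‖ < p) :
    ‖(Pfam p l)^[m] z - (Pfam p l')^[m] z'‖ ≤ (p : ℝ) ^ m * max ‖z - z'‖ ‖l - l'‖ ∧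
      (‖l - l'‖ ≤ ‖z - z'‖ →
        ‖(Pfam p l)^[m] z - (Pfam p l')^[m] z'‖ = (p : ℝ) ^ m * ‖z - z'‖) := by
  have hP : (1 : ℝ) < p := by exact_mod_cast hp.one_lt
  induction m with
  | zero => simp
  | succ m ih =>
    have small {w : K} (hw : (p : ℝ) ^ (m + 1) * ‖w - 1‖ < p) : (p : ℝ) ^ m * ‖w - 1‖ < 1 := by
      rw [pow_succ] at hw
      nlinarith
    have hs := small hz
    have hs' := small hz'
    obtain ⟨ih₁, ih₂⟩ := ih (hs.trans hP) (hs'.trans hP)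
    rw [← norm_iterate_Pfam_sub_one hp hpnorm hl (hs.trans hP) le_rfl] at hs
    rw [← norm_iterate_Pfam_sub_one hp hpnorm hl' (hs'.trans hP) le_rfl] at hs'
    rw [Function.iterate_succ_apply', Function.iterate_succ_apply', Pfam_sub_Pfam_eq]
    set w := (Pfam p l)^[m] z
    set w' := (Pfam p l')^[m] z'
    have hw' : ‖w'‖ = 1 := by
      rw [norm_eq_of_norm_sub_lt (a := 1) (by simpa using hs'), norm_one]
    have h1 : ‖Pfam p l w - Pfam p l w'‖ = p * ‖w - w'‖ :=
      norm_Pfam_sub_Pfam_near_one hp hpnorm hl hs hs'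
    have h2 : ‖(l - l') / (p : K) * w' ^ p * (1 - w')‖ = p * ‖l - l'‖ * ‖w' - 1‖ := by
      rw [norm_mul, norm_mul, norm_div, hpnorm, norm_pow, hw', norm_sub_rev 1 w']
      field_simp
      simp
    have hPm : (1 : ℝ) ≤ (p : ℝ) ^ m := one_le_pow₀ hP.le
    constructor
    · refine (IsUltrametricDist.norm_add_le_max _ _).trans (max_le ?_ ?_)
      · rw [h1, pow_succ', mul_assoc]
        gcongr
      · rw [h2, pow_succ', mul_assoc, mul_assoc]
        refine mul_le_mul_of_nonneg_left ?_ (by positivity)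
        have h3 : ‖l - l'‖ * ‖w' - 1‖ ≤ ‖l - l'‖ := mul_le_of_le_one_right (norm_nonneg _) hs'.le
        have h4 := le_max_right ‖z - z'‖ ‖l - l'‖
        have h5 : 0 ≤ max ‖z - z'‖ ‖l - l'‖ := (norm_nonneg _).trans h4
        nlinarith
    · intro hle
      have ih₂ := ih₂ hle
      rcases (norm_nonneg (l - l')).eq_or_lt with h0 | h0
      · have h3 : l - l' = 0 := norm_eq_zero.1 h0.symm
        rw [h3, zero_div, zero_mul, zero_mul, add_zero, h1, ih₂]
        ring
      · rw [norm_add_eq_left_of_norm_lt, h1, ih₂]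
        · ring
        · rw [h1, h2, ih₂, mul_assoc]
          refine mul_lt_mul_of_pos_left ?_ (by positivity)
          nlinarith [norm_nonneg (z - z')]

/-- A sequence of radii, each the size of the points near `0` mapped to points of the
preceding radius. -/
structure IsRadii (p : ℕ) (r : ℕ → ℝ) : Prop where
  pos : ∀ m, 0 < r m
  mul_pow : ∀ m, p * r (m + 1) ^ p = r m

omit [IsUltrametricDist K] in
theorem exists_radii [IsAlgClosed K] (hp : p.Prime) (hpnorm : ‖(p : K)‖ = (p : ℝ)⁻¹) {y : K}
    (hy : y ≠ 0) : ∃ b : ℕ → K, b 0 = y ∧ IsRadii p fun m => ‖b m‖ := by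
  choose root hroot using fun y : K => IsAlgClosed.exists_pow_nat_eq y hp.pos
  have hP : (p : ℝ) ≠ 0 := by exact_mod_cast hp.ne_zero
  have hmul (m : ℕ) (y : K) : p * ‖root (p * y)‖ ^ p = ‖y‖ := by
    rw [← norm_pow, hroot, norm_mul, hpnorm, mul_inv_cancel_left₀ hP]
  let b : ℕ → K := fun m => (fun y => root (p * y))^[m] y
  have hb (m : ℕ) : b (m + 1) = root (p * b m) := Function.iterate_succ_apply' _ _ _
  have hmul' (m : ℕ) : p * ‖b (m + 1)‖ ^ p = ‖b m‖ := by rw [hb, hmul m]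
  refine ⟨b, rfl, fun m => ?_, hmul'⟩
  induction m with
  | zero => exact norm_pos_iff.2 hy
  | succ m ih =>
    have := hmul' m
    by_contra h
    have h0 : ‖b (m + 1)‖ = 0 := le_antisymm (not_lt.1 h) (norm_nonneg _)
    rw [h0, zero_pow hp.ne_zero, mul_zero] at this
    exact ih.ne this

namespace IsRadii

variable {r : ℕ → ℝ}

theorem inv_lt (hr : IsRadii p r) (hp : p.Prime) (h0 : 1 ≤ r 0) (m : ℕ) : (p : ℝ)⁻¹ < r m := by
  have hP : (1 : ℝ) < p := by exact_mod_cast hp.one_lt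
  have hQ : (p : ℝ)⁻¹ < 1 := inv_lt_one_of_one_lt₀ hP
  induction m with
  | zero => exact hQ.trans_le h0
  | succ m ih =>
    refine lt_of_pow_lt_pow_left₀ p (hr.pos _).le ?_
    calc ((p : ℝ)⁻¹) ^ p ≤ ((p : ℝ)⁻¹) ^ 2 :=
          pow_le_pow_of_le_one (by positivity) hQ.le hp.two_le
      _ < (p : ℝ)⁻¹ * r m := by rw [sq]; gcongr
      _ = r (m + 1) ^ p := by rw [← hr.mul_pow m, inv_mul_cancel_left₀ (by positivity)]

theorem lt_one (hr : IsRadii p r) (hp : p.Prime) (h0 : r 0 < p) (m : ℕ) : r (m + 1) < 1 := by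
  have hP : (1 : ℝ) < p := by exact_mod_cast hp.one_lt
  have step (m : ℕ) (h : r m < p) : r (m + 1) < 1 := by
    refine lt_of_pow_lt_pow_left₀ p zero_le_one ?_
    have := hr.mul_pow m
    rw [one_pow]
    nlinarith
  induction m with
  | zero => exact step 0 h0
  | succ m ih => exact step _ (ih.trans hP)

theorem le_radius_one (hr : IsRadii p r) (hp : p.Prime) (h0 : r 0 = 1) (m : ℕ) :
    r (m + 1) ≤ r 1 := by
  have hP : (1 : ℝ) < p := by exact_mod_cast hp.one_lt
  have hle : r m ≤ r 0 := by
    cases m with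
    | zero => exact le_rfl
    | succ m => exact h0 ▸ (hr.lt_one hp (h0 ▸ hP) m).le
  refine le_of_pow_le_pow_left₀ hp.ne_zero (hr.pos _).le ?_
  rw [← hr.mul_pow, ← hr.mul_pow 0] at hle
  exact le_of_mul_le_mul_left hle (by positivity)

theorem norm_iterate_Pfam (hr : IsRadii p r) (hp : p.Prime) (hpnorm : ‖(p : K)‖ = (p : ℝ)⁻¹)
    (h0 : r 0 < p) {l z : K} (hl : ‖l - 1‖ < 1) {m : ℕ} (j : ℕ) (hz : ‖z‖ = r (m + j)) :
    ‖(Pfam p l)^[j] z‖ = r m := by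
  induction j generalizing z with
  | zero => exact hz
  | succ j ih =>
    rw [Function.iterate_succ_apply]
    apply ih
    rw [norm_Pfam_of_norm_lt_one hp hpnorm hl (hz.trans_lt (hr.lt_one hp h0 _)), hz]
    exact hr.mul_pow _

theorem norm_eq_of_norm_iterate_Pfam (hr : IsRadii p r) (hp : p.Prime)
    (hpnorm : ‖(p : K)‖ = (p : ℝ)⁻¹) {s : ℕ → ℝ} (hs : IsRadii p s) (hs₀ : s 0 < p) {l z : K}
    (hl : ‖l - 1‖ < 1) {m : ℕ} (hz : ‖z‖ ≤ s m) (h : ‖(Pfam p l)^[m] z‖ = r 0) :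
    ‖z‖ = r m := by
  induction m generalizing z with
  | zero => exact h
  | succ m ih =>
    have hP : (0 : ℝ) < p := by exact_mod_cast hp.pos
    have hn := norm_Pfam_of_norm_lt_one hp hpnorm hl (hz.trans_lt (hs.lt_one hp hs₀ m))
    have := ih (z := Pfam p l z) (by rw [hn, ← hs.mul_pow m]; gcongr) h
    rw [hn, ← hr.mul_pow m] at this
    exact (pow_left_inj₀ (norm_nonneg _) (hr.pos _).le hp.ne_zero).1
      (mul_left_cancel₀ hP.ne' this)

theorem norm_iterate_Pfam_sub_iterate_Pfam (hr : IsRadii p r) (hp : p.Prime)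
    (hpnorm : ‖(p : K)‖ = (p : ℝ)⁻¹) (h0 : r 0 = 1) {l l' z z' : K} (hl : ‖l - 1‖ < 1)
    (hl' : ‖l' - 1‖ < 1) (hll' : ‖l - l'‖ ≤ (p : ℝ)⁻¹) {m : ℕ} {t : ℝ} (hz : ‖z‖ = r m)
    (hz' : ‖z'‖ = r m) (ht₀ : 0 ≤ t) (ht : t ≤ (p : ℝ)⁻¹) (hzz' : ‖z - z'‖ ≤ r m * t) :
    ‖(Pfam p l)^[m] z - (Pfam p l')^[m] z'‖ ≤ max (r 1 ^ m * t) ‖l - l'‖ ∧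
      (0 < m → r 1 ^ m * t < ‖l - l'‖ →
        ‖(Pfam p l)^[m] z - (Pfam p l')^[m] z'‖ = ‖l - l'‖) := by
  have hP : (1 : ℝ) < p := by exact_mod_cast hp.one_lt
  have h0p : r 0 < p := h0 ▸ hP
  have hβ₁ : r 1 < 1 := hr.lt_one hp h0p 0
  have hβ₀ : 0 < r 1 := hr.pos 1
  induction m generalizing z z' t with
  | zero => simpa [h0] using Or.inl hzz'
  | succ m ih =>
    have hlt := hr.lt_one hp h0p m
    obtain ⟨h1, h2⟩ := norm_Pfam_sub_Pfam_near_zero hp hpnorm hl hz hz' (hr.pos _) hlt ht₀ ht hzz'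
      (hr.le_radius_one hp h0 m) (hr.inv_lt hp h0.ge 1).le (l' := l')
    rw [hr.mul_pow] at h1 h2
    have hn := norm_Pfam_of_norm_lt_one hp hpnorm hl (hz.trans_lt hlt)
    have hn' := norm_Pfam_of_norm_lt_one hp hpnorm hl' (hz'.trans_lt hlt)
    rw [hz, hr.mul_pow] at hn
    rw [hz', hr.mul_pow] at hn'
    have hβt : r 1 * t ≤ t := mul_le_of_le_one_left ht₀ hβ₁.le
    obtain ⟨ih₁, ih₂⟩ := ih hn hn' (le_max_of_le_right (norm_nonneg _))
      (max_le (hβt.trans ht) hll') h1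
    simp only [Function.iterate_succ_apply]
    have hpow : r 1 ^ m ≤ 1 := pow_le_one₀ hβ₀.le hβ₁.le
    have hmax : r 1 ^ m * max (r 1 * t) ‖l - l'‖ ≤ max (r 1 ^ (m + 1) * t) ‖l - l'‖ := by
      rw [mul_max_of_nonneg _ _ (by positivity), pow_succ, mul_assoc]
      exact max_le_max le_rfl (mul_le_of_le_one_left (norm_nonneg _) hpow)
    refine ⟨ih₁.trans (max_le hmax (le_max_right _ _)), fun _ hlt' => ?_⟩
    rcases Nat.eq_zero_or_pos m with rfl | hm
    · rw [h0, one_mul] at h2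
      exact h2 (by simpa using hlt')
    · refine ih₂ hm ?_
      have hpos : 0 < ‖l - l'‖ := lt_of_le_of_lt (by positivity) hlt'
      rw [mul_max_of_nonneg _ _ (by positivity)]
      refine max_lt (by rwa [← mul_assoc, ← pow_succ]) ?_
      exact mul_lt_of_lt_one_left hpos (pow_lt_one₀ hβ₀.le hβ₁ hm.ne')

end IsRadii

end Family

section Construction

variable {K : Type*} [NontriviallyNormedField K] {p : ℕ}

/-- The orbit of `x` under `P_l` reaches the repelling fixed point `1` at time `n`, and at this
time, up to an error `p⁻¹ ^ (k + 3)`, the orbits of the points of `closedBall x s` for parameters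
`p⁻¹ ^ k * β`-close to `l` depend isometrically on the parameter. -/
structure IsHittingStage (p : ℕ) (x : K) (s β : ℝ) (l : K) (n k : ℕ) : Prop where
  norm_sub_one_lt : ‖l - 1‖ < 1
  one_le : 1 ≤ k
  iterate_eq_one : (Pfam p l)^[n] x = 1
  norm_sub_le : ∀ l₁ ∈ closedBall l ((p : ℝ)⁻¹ ^ k * β), ∀ l₂ ∈ closedBall l ((p : ℝ)⁻¹ ^ k * β),
    ∀ x₁ ∈ closedBall x s, ∀ x₂ ∈ closedBall x s,
      ‖(Pfam p l₁)^[n] x₁ - (Pfam p l₂)^[n] x₂‖ ≤ max ((p : ℝ)⁻¹ ^ (k + 3)) ‖l₁ - l₂‖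
  norm_sub_eq : ∀ l₁ ∈ closedBall l ((p : ℝ)⁻¹ ^ k * β), ∀ l₂ ∈ closedBall l ((p : ℝ)⁻¹ ^ k * β),
    ∀ x₁ ∈ closedBall x s, ∀ x₂ ∈ closedBall x s, (p : ℝ)⁻¹ ^ (k + 3) < ‖l₁ - l₂‖ →
      ‖(Pfam p l₁)^[n] x₁ - (Pfam p l₂)^[n] x₂‖ = ‖l₁ - l₂‖

variable [IsUltrametricDist K] [IsAlgClosed K]

theorem IsHittingStage.exists_next (hp : p.Prime) (hpnorm : ‖(p : K)‖ = (p : ℝ)⁻¹)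
    {b c : ℕ → K} (hb₀ : b 0 = 1) (hb : IsRadii p fun m => ‖b m‖) (hc₀ : c 0 = (b 1)⁻¹)
    (hc : IsRadii p fun m => ‖c m‖) {x : K} {s : ℝ} (hs : 0 < s) {l : K} {n k : ℕ}
    (h : IsHittingStage p x s ‖b 1‖ l n k) :
    ∃ l' n', n < n' ∧ IsHittingStage p x s ‖b 1‖ l' n' (k + 3) ∧
      ‖l' - l‖ ≤ (p : ℝ)⁻¹ ^ k * ‖b 1‖ ∧
      ∀ l₁ ∈ closedBall l' ((p : ℝ)⁻¹ ^ (k + 3) * ‖b 1‖),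
        (∀ x₁ ∈ closedBall x s, ‖(Pfam p l₁)^[n] x₁ - 1‖ = (p : ℝ)⁻¹ ^ (k + 1)) ∧
        ∀ j, n ≤ j → j < n' →
          ∃ a ≤ 1, ∀ x₁ ∈ closedBall x s, ‖(Pfam p l₁)^[j] x₁ - 1‖ = a := by
  have hP : (1 : ℝ) < p := by exact_mod_cast hp.one_lt
  set q : ℝ := (p : ℝ)⁻¹ with hq
  set β : ℝ := ‖b 1‖ with hβ
  have hb₀' : ‖b 0‖ = 1 := by rw [hb₀, norm_one]
  have hb₀p : ‖b 0‖ < p := hb₀'.trans_lt hP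
  have hq₀ : 0 < q := by positivity
  have hq₁ : q < 1 := inv_lt_one_of_one_lt₀ hP
  have hpq : (p : ℝ) * q = 1 := mul_inv_cancel₀ (by positivity)
  have hqβ : q < β := hb.inv_lt hp hb₀'.ge 1
  have hβ₀ : 0 < β := hq₀.trans hqβ
  have hβ₁ : β < 1 := hb.lt_one hp hb₀p 0
  have hpβ : 1 < p * β := by rw [← hpq]; gcongr
  have hc₀' : ‖c 0‖ = β⁻¹ := by rw [hc₀, norm_inv]
  have hc₀1 : 1 < ‖c 0‖ := by rw [hc₀']; exact (one_lt_inv₀ hβ₀).2 hβ₁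
  have hc₀p : ‖c 0‖ < p := by
    rw [hc₀', ← inv_inv (p : ℝ)]; exact inv_strictAnti₀ hq₀ hqβ
  have hpqk (m : ℕ) : (p : ℝ) ^ m * q ^ m = 1 := by rw [← mul_pow, hpq, one_pow]
  have hkβ : (p : ℝ) ^ (k + 1) * (q ^ k * β) = p * β := by
    calc (p : ℝ) ^ (k + 1) * (q ^ k * β) = (p ^ k * q ^ k) * (p * β) := by ring
      _ = _ := by rw [hpqk, one_mul]
  have hk1 : q ^ (k + 1) < q ^ k * β := by rw [pow_succ]; gcongr
  have hk3 : q ^ (k + 3) < q ^ (k + 1) * q := by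
    rw [← pow_succ]; exact pow_lt_pow_right_of_lt_one₀ hq₀ hq₁ (by omega)
  have hk3' : q ^ (k + 3) ≤ q ^ k * β :=
    (hk3.trans ((mul_lt_of_lt_one_right (by positivity) hq₁).trans hk1)).le
  have hkq : q ^ k * β ≤ q := by
    calc q ^ k * β ≤ q ^ 1 * 1 :=
          mul_le_mul (pow_le_pow_of_le_one hq₀.le hq₁.le h.one_le) hβ₁.le hβ₀.le (by positivity)
      _ = q := by simp
  have hlU : l ∈ closedBall l (q ^ k * β) := mem_closedBall_self (by positivity)
  have hxD : x ∈ closedBall x s := mem_closedBall_self hs.le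
  have hU₁ {l₁ : K} (h₁ : l₁ ∈ closedBall l (q ^ k * β)) : ‖l₁ - 1‖ < 1 := by
    rw [mem_closedBall, dist_eq_norm] at h₁
    have := IsUltrametricDist.norm_add_le_max (l₁ - l) (l - 1)
    rw [sub_add_sub_cancel] at this
    exact this.trans_lt (max_lt (h₁.trans_lt (hkq.trans_lt hq₁)) h.norm_sub_one_lt)
  have near {l₁ x₁ : K} (h₁ : l₁ ∈ closedBall l (q ^ k * β)) (hx₁ : x₁ ∈ closedBall x s) :
      (p : ℝ) ^ (k + 1) * ‖(Pfam p l₁)^[n] x₁ - 1‖ < p := by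
    have := h.norm_sub_le l₁ h₁ l hlU x₁ hx₁ x hxD
    rw [h.iterate_eq_one] at this
    rw [mem_closedBall, dist_eq_norm] at h₁
    calc (p : ℝ) ^ (k + 1) * ‖(Pfam p l₁)^[n] x₁ - 1‖ ≤ p ^ (k + 1) * (q ^ k * β) := by
          gcongr; exact this.trans (max_le hk3' h₁)
      _ = p * β := hkβ
      _ < p := mul_lt_of_lt_one_right (by positivity) hβ₁
  have escape {l₁ l₂ x₁ x₂ : K} (h₁ : l₁ ∈ closedBall l (q ^ k * β))
      (h₂ : l₂ ∈ closedBall l (q ^ k * β)) (hx₁ : x₁ ∈ closedBall x s)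
      (hx₂ : x₂ ∈ closedBall x s) :
      ‖(Pfam p l₁)^[k + 1 + n] x₁ - (Pfam p l₂)^[k + 1 + n] x₂‖ ≤
        (p : ℝ) ^ (k + 1) * max (q ^ (k + 3)) ‖l₁ - l₂‖ := by
    rw [Function.iterate_add_apply _ (k + 1) n x₁, Function.iterate_add_apply _ (k + 1) n x₂]
    refine (norm_iterate_Pfam_sub_iterate_Pfam_near_one hp hpnorm (hU₁ h₁) (hU₁ h₂)
      (near h₁ hx₁) (near h₂ hx₂)).1.trans ?_
    exact mul_le_mul_of_nonneg_left
      (max_le (h.norm_sub_le l₁ h₁ l₂ h₂ x₁ hx₁ x₂ hx₂) (le_max_right _ _)) (by positivity)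
  have escape_eq {l₁ l₂ : K} (h₁ : l₁ ∈ closedBall l (q ^ k * β))
      (h₂ : l₂ ∈ closedBall l (q ^ k * β)) (hlt : q ^ (k + 3) < ‖l₁ - l₂‖) :
      ‖(Pfam p l₁)^[k + 1 + n] x - (Pfam p l₂)^[k + 1 + n] x‖ = (p : ℝ) ^ (k + 1) * ‖l₁ - l₂‖ := by
    have heq := h.norm_sub_eq l₁ h₁ l₂ h₂ x hxD x hxD hlt
    rw [Function.iterate_add_apply (Pfam p l₁) (k + 1) n x,
      Function.iterate_add_apply (Pfam p l₂) (k + 1) n x,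
      (norm_iterate_Pfam_sub_iterate_Pfam_near_one hp hpnorm (hU₁ h₁) (hU₁ h₂)
      (near h₁ hxD) (near h₂ hxD)).2 heq.ge, heq]
  -- a parameter for which the orbit of `x` hits the critical fixed point `0`
  obtain ⟨l₀, hl₀, hl₀U⟩ : ∃ l₀, (Pfam p l₀)^[k + 1 + n] x = 0 ∧ ‖l₀ - l‖ ≤ q ^ k * β := by
    have hul : ‖(l + (p : K) ^ k * b 1) - l‖ = q ^ k * β := by
      rw [add_sub_cancel_left, norm_mul, norm_pow, hpnorm]
    have hl1 : (Pfam p l)^[k + 1 + n] x = 1 := by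
      rw [Function.iterate_add_apply _ (k + 1) n x, h.iterate_eq_one,
        Function.iterate_fixed (Pfam_one l)]
    obtain ⟨w, hw, hwl⟩ := exists_param_iterate_Pfam_eq (p := p) x 0 (k + 1 + n) (a := l)
      (u := l + (p : K) ^ k * b 1) (by
        have h2 := escape_eq (l₁ := l + (p : K) ^ k * b 1) (l₂ := l)
          (by rw [mem_closedBall, dist_eq_norm, hul]) hlU
          (by rw [hul]; exact hk3.trans ((mul_lt_of_lt_one_right (by positivity) hq₁).trans hk1))
        rw [hul, hkβ, hl1] at h2
        rw [hl1, sub_zero, sub_zero, norm_one]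
        intro h3
        have := norm_sub_le_of_norm_sub_le (c := 0) (r := 1)
          (a := (Pfam p (l + (p : K) ^ k * b 1))^[k + 1 + n] x) (b := 1)
          (by rw [sub_zero, h3]) (by simp)
        linarith)
    exact ⟨w, hw, hwl.trans hul.le⟩
  have hl₀U' : l₀ ∈ closedBall l (q ^ k * β) := by rwa [mem_closedBall, dist_eq_norm]
  obtain ⟨M, hM⟩ := exists_pow_lt_of_lt_one (show 0 < q ^ (k + 6) by positivity) hβ₁
  have hcM : q < ‖c (M + 1)‖ := hc.inv_lt hp hc₀1.le (M + 1)
  have hcM₁ : ‖c (M + 1)‖ < 1 := hc.lt_one hp hc₀p M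
  have hbM : q < ‖b (M + 1)‖ := hb.inv_lt hp hb₀'.ge (M + 1)
  -- a parameter for which the orbit of `x` hits `1` after `M + 1` further steps
  obtain ⟨l', hl', hl'l₀⟩ : ∃ l', (Pfam p l')^[M + 1 + (k + 1 + n)] x = 1 ∧
      ‖l' - l₀‖ ≤ q ^ (k + 1) * ‖c (M + 1)‖ := by
    have hul : ‖(l₀ + (p : K) ^ (k + 1) * c (M + 1)) - l₀‖ = q ^ (k + 1) * ‖c (M + 1)‖ := by
      rw [add_sub_cancel_left, norm_mul, norm_pow, hpnorm]
    obtain ⟨w, hw, hwl⟩ := exists_param_iterate_Pfam_eq (p := p) x 1 (M + 1 + (k + 1 + n))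
      (a := l₀) (u := l₀ + (p : K) ^ (k + 1) * c (M + 1)) (by
        set u := l₀ + (p : K) ^ (k + 1) * c (M + 1) with hu
        have huU : u ∈ closedBall l (q ^ k * β) := by
          rw [mem_closedBall, dist_eq_norm]
          refine norm_sub_le_of_norm_sub_le (c := l₀) ?_ (by rwa [norm_sub_rev])
          rw [hul]
          exact ((mul_lt_of_lt_one_right (by positivity) hcM₁).trans hk1).le
        have h2 := escape_eq huU hl₀U' (by rw [hul]; exact hk3.trans (by gcongr))
        rw [hul, ← mul_assoc, hpqk, one_mul, hl₀, sub_zero] at h2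
        have h3 := hc.norm_iterate_Pfam hp hpnorm hc₀p (hU₁ huU) (m := 0) (M + 1)
          (h2.trans (by rw [zero_add]))
        rw [← Function.iterate_add_apply] at h3
        rw [Function.iterate_add_apply (Pfam p l₀) (M + 1) (k + 1 + n) x, hl₀,
          Function.iterate_fixed (Pfam_zero hp l₀), norm_sub_one_of_one_lt (by rwa [h3]), h3]
        simpa using hc₀1.ne')
    exact ⟨w, hw, hwl.trans hul.le⟩
  have hl'l : ‖l' - l‖ ≤ q ^ k * β := by
    refine norm_sub_le_of_norm_sub_le (c := l₀) (hl'l₀.trans ?_) (by rwa [norm_sub_rev])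
    exact ((mul_lt_of_lt_one_right (by positivity) hcM₁).trans hk1).le
  have hl'U : l' ∈ closedBall l (q ^ k * β) := by rwa [mem_closedBall, dist_eq_norm]
  have hl'n : ‖(Pfam p l')^[k + 1 + n] x‖ = ‖b (M + 1)‖ := by
    refine hb.norm_eq_of_norm_iterate_Pfam hp hpnorm hc hc₀p (hU₁ hl'U) ?_ ?_
    · have := escape hl'U hl₀U' hxD hxD
      rw [hl₀, sub_zero] at this
      refine this.trans ?_
      calc (p : ℝ) ^ (k + 1) * max (q ^ (k + 3)) ‖l' - l₀‖
          ≤ p ^ (k + 1) * (q ^ (k + 1) * ‖c (M + 1)‖) := by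
            gcongr
            exact max_le (hk3.le.trans (by gcongr)) hl'l₀
        _ = _ := by rw [← mul_assoc, hpqk, one_mul]
    · rw [← Function.iterate_add_apply, hl', hb₀', norm_one]
  have hsub {l₁ : K} (h₁ : l₁ ∈ closedBall l' (q ^ (k + 3) * β)) :
      l₁ ∈ closedBall l (q ^ k * β) := by
    rw [mem_closedBall, dist_eq_norm] at h₁ ⊢
    refine norm_sub_le_of_norm_sub_le (c := l') (h₁.trans ?_) (by rwa [norm_sub_rev])
    exact (mul_le_of_le_one_right (by positivity) hβ₁.le).trans hk3'
  have close {l₁ l₂ x₁ x₂ : K} (h₁ : l₁ ∈ closedBall l' (q ^ (k + 3) * β))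
      (h₂ : l₂ ∈ closedBall l' (q ^ (k + 3) * β)) (hx₁ : x₁ ∈ closedBall x s)
      (hx₂ : x₂ ∈ closedBall x s) :
      ‖(Pfam p l₁)^[k + 1 + n] x₁ - (Pfam p l₂)^[k + 1 + n] x₂‖ ≤ q ^ 2 := by
    refine (escape (hsub h₁) (hsub h₂) hx₁ hx₂).trans ?_
    rw [mem_closedBall, dist_eq_norm] at h₁ h₂
    have h₁₂ : ‖l₁ - l₂‖ ≤ q ^ (k + 3) * β :=
      norm_sub_le_of_norm_sub_le h₁ h₂
    calc (p : ℝ) ^ (k + 1) * max (q ^ (k + 3)) ‖l₁ - l₂‖ ≤ p ^ (k + 1) * q ^ (k + 3) := by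
          gcongr
          exact max_le le_rfl (h₁₂.trans (mul_le_of_le_one_right (by positivity) hβ₁.le))
      _ = (p ^ (k + 1) * q ^ (k + 1)) * q ^ 2 := by ring
      _ = q ^ 2 := by rw [hpqk, one_mul]
  have hl'self : l' ∈ closedBall l' (q ^ (k + 3) * β) := mem_closedBall_self (by positivity)
  have hq2 : q ^ 2 < q := by rw [sq]; exact mul_lt_of_lt_one_right hq₀ hq₁
  have norm_eq {l₁ x₁ : K} (h₁ : l₁ ∈ closedBall l' (q ^ (k + 3) * β))
      (hx₁ : x₁ ∈ closedBall x s) : ‖(Pfam p l₁)^[k + 1 + n] x₁‖ = ‖b (M + 1)‖ := by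
    rw [← hl'n]
    apply norm_eq_of_norm_sub_lt
    rw [hl'n]
    exact (close h₁ hl'self hx₁ hxD).trans_lt (hq2.trans hbM)
  have norm_n {l₁ x₁ : K} (h₁ : l₁ ∈ closedBall l' (q ^ (k + 3) * β))
      (hx₁ : x₁ ∈ closedBall x s) : ‖(Pfam p l₁)^[n] x₁ - 1‖ = q ^ (k + 1) := by
    have h1 := norm_iterate_Pfam_sub_one hp hpnorm (hU₁ (hsub h₁)) (near (hsub h₁) hx₁) le_rfl
    rw [← Function.iterate_add_apply, norm_sub_one_eq_one, ← hpqk (k + 1)] at h1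
    · exact (mul_left_cancel₀ (by positivity) h1).symm
    · rw [norm_eq h₁ hx₁]
      exact hb.lt_one hp hb₀p M
  have zero_block {l₁ l₂ x₁ x₂ : K} (h₁ : l₁ ∈ closedBall l' (q ^ (k + 3) * β))
      (h₂ : l₂ ∈ closedBall l' (q ^ (k + 3) * β)) (hx₁ : x₁ ∈ closedBall x s)
      (hx₂ : x₂ ∈ closedBall x s) :=
    hb.norm_iterate_Pfam_sub_iterate_Pfam hp hpnorm hb₀' (hU₁ (hsub h₁)) (hU₁ (hsub h₂))
      (by
        have h₁ := hsub h₁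
        have h₂ := hsub h₂
        rw [mem_closedBall, dist_eq_norm] at h₁ h₂
        exact (norm_sub_le_of_norm_sub_le h₁ h₂).trans hkq)
      (norm_eq h₁ hx₁) (norm_eq h₂ hx₂) hq₀.le le_rfl
      ((close h₁ h₂ hx₁ hx₂).trans (by rw [sq]; gcongr))
  have hσ : β ^ (M + 1) * q ≤ q ^ (k + 6) := by
    calc β ^ (M + 1) * q ≤ β ^ M * 1 :=
          mul_le_mul (pow_le_pow_of_le_one hβ₀.le hβ₁.le (by omega)) hq₁.le hq₀.le (by positivity)
      _ ≤ q ^ (k + 6) := by rw [mul_one]; exact hM.le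
  refine ⟨l', M + 1 + (k + 1 + n), by omega, ⟨hU₁ hl'U, by omega, hl', ?_, ?_⟩, hl'l,
    fun l₁ h₁ => ⟨fun x₁ hx₁ => norm_n h₁ hx₁, fun j hj hj' => ?_⟩⟩
  · intro l₁ h₁ l₂ h₂ x₁ hx₁ x₂ hx₂
    rw [Function.iterate_add_apply _ (M + 1) (k + 1 + n) x₁,
      Function.iterate_add_apply _ (M + 1) (k + 1 + n) x₂]
    exact (zero_block h₁ h₂ hx₁ hx₂).1.trans (max_le_max hσ le_rfl)
  · intro l₁ h₁ l₂ h₂ x₁ hx₁ x₂ hx₂ hlt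
    rw [Function.iterate_add_apply _ (M + 1) (k + 1 + n) x₁,
      Function.iterate_add_apply _ (M + 1) (k + 1 + n) x₂]
    exact (zero_block h₁ h₂ hx₁ hx₂).2 (by omega) (hσ.trans_lt hlt)
  · rcases lt_or_ge j (k + 1 + n) with hjk | hjk
    · obtain ⟨i, rfl⟩ := Nat.exists_eq_add_of_le' hj
      refine ⟨p ^ i * q ^ (k + 1), ?_, fun x₁ hx₁ => ?_⟩
      · rw [← hpqk (k + 1)]
        gcongr
        · exact hP.le
        · omega
      · rw [Function.iterate_add_apply _ i n x₁, norm_iterate_Pfam_sub_one hp hpnorm (hU₁ (hsub h₁))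
          (near (hsub h₁) hx₁) (by omega), norm_n h₁ hx₁]
    · obtain ⟨i, rfl⟩ := Nat.exists_eq_add_of_le' hjk
      refine ⟨1, le_rfl, fun x₁ hx₁ => norm_sub_one_eq_one ?_⟩
      rw [Function.iterate_add_apply _ i (k + 1 + n) x₁,
        hb.norm_iterate_Pfam hp hpnorm hb₀p (hU₁ (hsub h₁))
        (m := M - i + 1) i]
      · exact hb.lt_one hp hb₀p _
      · rw [norm_eq h₁ hx₁]
        congr 2
        omega

end Construction

section WanderingDisc

variable {K : Type*} [NontriviallyNormedField K] [IsUltrametricDist K] [IsAlgClosed K] {p : ℕ}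

theorem exists_isHittingStage_one (hp : p.Prime) (hpnorm : ‖(p : K)‖ = (p : ℝ)⁻¹)
    {b c : ℕ → K} (hb₀ : b 0 = 1) (hb : IsRadii p fun m => ‖b m‖) (hc₀ : c 0 = (b 1)⁻¹)
    (hc : IsRadii p fun m => ‖c m‖) {l : K} (hl : ‖l - 1‖ < 1) {k : ℕ} (hk : 1 ≤ k) :
    ∃ x, ‖x‖ = ‖b 1‖ ∧ IsHittingStage p x (‖b 1‖ * (p : ℝ)⁻¹ ^ (k + 3)) ‖b 1‖ l 1 k := by
  have hP : (1 : ℝ) < p := by exact_mod_cast hp.one_lt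
  set q : ℝ := (p : ℝ)⁻¹ with hq
  set β : ℝ := ‖b 1‖ with hβ
  have hb₀' : ‖b 0‖ = 1 := by rw [hb₀, norm_one]
  have hq₀ : 0 < q := by positivity
  have hq₁ : q < 1 := inv_lt_one_of_one_lt₀ hP
  have hqβ : q < β := hb.inv_lt hp hb₀'.ge 1
  have hβ₀ : 0 < β := hq₀.trans hqβ
  have hβ₁ : β < 1 := hb.lt_one hp (hb₀'.trans_lt hP) 0
  have hc₀' : ‖c 0‖ = β⁻¹ := by rw [hc₀, norm_inv]
  have hc₀1 : 1 < ‖c 0‖ := by rw [hc₀']; exact (one_lt_inv₀ hβ₀).2 hβ₁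
  have hc₀p : ‖c 0‖ < p := by
    rw [hc₀', ← inv_inv (p : ℝ)]; exact inv_strictAnti₀ hq₀ hqβ
  obtain ⟨x, hx, hxc⟩ := exists_Pfam_eq (p := p) l 1 (a := 0) (u := c 1) (by
    have h1 : ‖Pfam p l (c 1)‖ = ‖c 0‖ := hc.norm_iterate_Pfam hp hpnorm hc₀p hl (m := 0) 1 rfl
    rw [Pfam_zero hp, norm_sub_one_of_one_lt (by rwa [h1]), h1]
    simpa using hc₀1.ne')
  rw [sub_zero, sub_zero] at hxc
  have hxβ : ‖x‖ = β :=
    hb.norm_eq_of_norm_iterate_Pfam hp hpnorm hc hc₀p hl (m := 1) hxc (by simp [hx, hb₀])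
  have hqk : q ^ k ≤ q := pow_le_of_le_one hq₀.le hq₁.le (by omega)
  have hqk3 : q ^ (k + 3) ≤ q := pow_le_of_le_one hq₀.le hq₁.le (by omega)
  have hqkβ : q ^ k * β ≤ q := (mul_le_of_le_one_right (by positivity) hβ₁.le).trans hqk
  have hU {l₁ : K} (h₁ : l₁ ∈ closedBall l (q ^ k * β)) : ‖l₁ - 1‖ < 1 := by
    rw [mem_closedBall, dist_eq_norm] at h₁
    have := IsUltrametricDist.norm_add_le_max (l₁ - l) (l - 1)
    rw [sub_add_sub_cancel] at this
    exact this.trans_lt (max_lt (h₁.trans_lt (hqkβ.trans_lt hq₁)) hl)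
  have hD {x₁ : K} (h₁ : x₁ ∈ closedBall x (β * q ^ (k + 3))) : ‖x₁‖ = β := by
    rw [mem_closedBall, dist_eq_norm] at h₁
    rw [← hxβ]
    apply norm_eq_of_norm_sub_lt
    rw [hxβ]
    exact h₁.trans_lt (mul_lt_of_lt_one_right hβ₀ (hqk3.trans_lt hq₁))
  have main {l₁ l₂ x₁ x₂ : K} (h₁ : l₁ ∈ closedBall l (q ^ k * β))
      (h₂ : l₂ ∈ closedBall l (q ^ k * β)) (hx₁ : x₁ ∈ closedBall x (β * q ^ (k + 3)))
      (hx₂ : x₂ ∈ closedBall x (β * q ^ (k + 3))) :=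
    hb.norm_iterate_Pfam_sub_iterate_Pfam hp hpnorm hb₀' (hU h₁) (hU h₂)
      (by
        rw [mem_closedBall, dist_eq_norm] at h₁ h₂
        exact (norm_sub_le_of_norm_sub_le h₁ h₂).trans hqkβ) (m := 1)
      (hD hx₁) (hD hx₂) (t := q ^ (k + 3)) (by positivity) hqk3
      (by
        rw [mem_closedBall, dist_eq_norm] at hx₁ hx₂
        exact norm_sub_le_of_norm_sub_le hx₁ hx₂)
  have hβq : ‖b 1‖ ^ 1 * q ^ (k + 3) ≤ q ^ (k + 3) := by
    rw [pow_one]; exact mul_le_of_le_one_left (by positivity) hβ₁.le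
  refine ⟨x, hxβ, hl, hk, hx, ?_, ?_⟩
  · intro l₁ h₁ l₂ h₂ x₁ hx₁ x₂ hx₂
    exact (main h₁ h₂ hx₁ hx₂).1.trans (max_le_max hβq le_rfl)
  · intro l₁ h₁ l₂ h₂ x₁ hx₁ x₂ hx₂ hlt
    exact (main h₁ h₂ hx₁ hx₂).2 one_pos (hβq.trans_lt hlt)

/-- Near every parameter there is one for which all points of some disc have the same distances
to the fixed point `1` along their orbits, these distances being at most `1` and having infinitely
many different values. -/
theorem exists_norm_iterate_Pfam_sub_one_eq [CompleteSpace K] (hp : p.Prime)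
    (hpnorm : ‖(p : K)‖ = (p : ℝ)⁻¹) {l₀ : K} (hl₀ : ‖l₀ - 1‖ < 1) {ε : ℝ} (hε : 0 < ε) :
    ∃ l : K, ‖l - 1‖ < 1 ∧ ‖l - l₀‖ ≤ ε ∧ ∃ (x : K) (s : ℝ) (a : ℕ → ℝ), 0 < s ∧
      (∀ j, a j ≤ 1) ∧ (∀ j, ∀ z ∈ closedBall x s, ‖(Pfam p l)^[j] z - 1‖ = a j) ∧
      ∃ n k : ℕ → ℕ, StrictMono n ∧ StrictMono k ∧ ∀ i, a (n i) = (p : ℝ)⁻¹ ^ k i := by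
  have hP : (1 : ℝ) < p := by exact_mod_cast hp.one_lt
  have hq₀ : 0 < (p : ℝ)⁻¹ := by positivity
  have hq₁ : (p : ℝ)⁻¹ < 1 := inv_lt_one_of_one_lt₀ hP
  obtain ⟨b, hb₀, hb⟩ := exists_radii hp hpnorm (one_ne_zero (α := K))
  have hβ₀ : 0 < ‖b 1‖ := hb.pos 1
  have hβ₁ : ‖b 1‖ < 1 := hb.lt_one hp (by rwa [hb₀, norm_one]) 0
  obtain ⟨c, hc₀, hc⟩ := exists_radii hp hpnorm (inv_ne_zero (norm_pos_iff.1 hβ₀))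
  obtain ⟨k₀, hk₀⟩ := exists_pow_lt_of_lt_one hε hq₁
  obtain ⟨x, hx, hstage⟩ := exists_isHittingStage_one hp hpnorm hb₀ hb hc₀ hc hl₀
    (k := k₀ + 1) (by omega)
  have hs : 0 < ‖b 1‖ * (p : ℝ)⁻¹ ^ (k₀ + 1 + 3) := by positivity
  have hs' : ‖b 1‖ * (p : ℝ)⁻¹ ^ (k₀ + 1 + 3) < ‖b 1‖ :=
    mul_lt_of_lt_one_right hβ₀ (pow_lt_one₀ hq₀.le hq₁ (by omega))
  set s := ‖b 1‖ * (p : ℝ)⁻¹ ^ (k₀ + 1 + 3)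
  choose! f g hlt hnext hdist horbit using
    fun (l : K) (n k : ℕ) (h : IsHittingStage p x s ‖b 1‖ l n k) =>
      h.exists_next hp hpnorm hb₀ hb hc₀ hc hs
  let k : ℕ → ℕ := fun i => k₀ + 1 + 3 * i
  let S : ℕ → K × ℕ := fun i =>
    Nat.rec (l₀, 1) (fun i S => (f S.1 S.2 (k i), g S.1 S.2 (k i))) i
  have hS (i : ℕ) : IsHittingStage p x s ‖b 1‖ (S i).1 (S i).2 (k i) := by
    induction i with
    | zero => exact hstage
    | succ i ih => exact hnext _ _ _ ih
  have hn : StrictMono fun i => (S i).2 := strictMono_nat_of_lt_succ fun i => hlt _ _ _ (hS i)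
  have hradius (i : ℕ) : (p : ℝ)⁻¹ ^ k i * ‖b 1‖ ≤ (p : ℝ)⁻¹ ^ i :=
    (mul_le_of_le_one_right (by positivity) hβ₁.le).trans
      (pow_le_pow_of_le_one hq₀.le hq₁.le (by simp only [k]; omega))
  have hanti : Antitone fun i => closedBall (S i).1 ((p : ℝ)⁻¹ ^ k i * ‖b 1‖) := by
    refine antitone_nat_of_succ_le fun i z hz => ?_
    rw [mem_closedBall, dist_eq_norm] at hz ⊢
    refine norm_sub_le_of_norm_sub_le (c := (S (i + 1)).1) (hz.trans ?_) ?_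
    · exact mul_le_mul_of_nonneg_right
        (pow_le_pow_of_le_one hq₀.le hq₁.le (by simp only [k]; omega)) hβ₀.le
    · rw [norm_sub_rev]
      exact hdist _ _ _ (hS i)
  have hself (i : ℕ) : (S i).1 ∈ closedBall (S i).1 ((p : ℝ)⁻¹ ^ k i * ‖b 1‖) :=
    mem_closedBall_self (by positivity)
  obtain ⟨l, hl⟩ := cauchySeq_tendsto_of_complete
    (cauchySeq_of_le_geometric (f := fun i => (S i).1) (p : ℝ)⁻¹ 1 hq₁ fun i => by
      have := hanti (Nat.le_succ i) (hself (i + 1))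
      rw [mem_closedBall, dist_comm] at this
      exact this.trans ((hradius i).trans (one_mul _).ge))
  have hlmem (i : ℕ) : l ∈ closedBall (S i).1 ((p : ℝ)⁻¹ ^ k i * ‖b 1‖) :=
    isClosed_closedBall.mem_of_tendsto hl
      ((eventually_ge_atTop i).mono fun m hm => hanti hm (hself m))
  have hll₀ : ‖l - l₀‖ ≤ (p : ℝ)⁻¹ ^ (k₀ + 1) * ‖b 1‖ := by
    simpa [mem_closedBall, dist_eq_norm, S, k] using hlmem 0
  have hq : (p : ℝ)⁻¹ ^ (k₀ + 1) * ‖b 1‖ ≤ (p : ℝ)⁻¹ ^ (k₀ + 1) :=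
    mul_le_of_le_one_right (by positivity) hβ₁.le
  have hl1 : ‖l - 1‖ < 1 := by
    have := IsUltrametricDist.norm_add_le_max (l - l₀) (l₀ - 1)
    rw [sub_add_sub_cancel] at this
    exact this.trans_lt (max_lt
      ((hll₀.trans hq).trans_lt (pow_lt_one₀ hq₀.le hq₁ (by omega))) hl₀)
  have hblock (i : ℕ) := horbit _ _ _ (hS i) l (hlmem (i + 1))
  have hbefore (i : ℕ) : ∀ j < (S i).2, ∃ a ≤ 1, ∀ z ∈ closedBall x s,
      ‖(Pfam p l)^[j] z - 1‖ = a := by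
    induction i with
    | zero =>
      intro j hj
      obtain rfl : j = 0 := by simpa [S] using hj
      refine ⟨1, le_rfl, fun z hz => norm_sub_one_eq_one ?_⟩
      rw [Function.iterate_zero, id, norm_eq_of_norm_sub_lt (a := x), hx]
      · exact hβ₁
      · rw [mem_closedBall, dist_eq_norm] at hz
        rw [hx]
        exact hz.trans_lt hs'
    | succ i ih =>
      intro j hj
      rcases lt_or_ge j (S i).2 with h | h
      · exact ih j h
      · exact (hblock i).2 j h hj
  choose a ha₁ ha using fun j => hbefore (j + 1) j ((Nat.lt_succ_self j).trans_le (hn.le_apply))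
  refine ⟨l, hl1, hll₀.trans (hq.trans ?_), x, s, a, hs, ha₁, ha, fun i => (S i).2,
    fun i => k i + 1, hn, fun i j hij => by simp only [k]; omega, fun i => ?_⟩
  · exact (pow_le_pow_of_le_one hq₀.le hq₁.le (Nat.le_succ _)).trans hk₀.le
  · rw [← ha _ x (mem_closedBall_self hs.le)]
    exact (hblock i).1 x (mem_closedBall_self hs.le)

end WanderingDisc

theorem finite_range_of_eq_add {α : Type*} {a : ℕ → α} {m d : ℕ} (hd : 0 < d)
    (h : ∀ j, m ≤ j → a j = a (j + d)) : (Set.range a).Finite := by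
  refine ((Set.finite_Iio (m + d)).image a).subset ?_
  rintro _ ⟨j, rfl⟩
  induction j using Nat.strong_induction_on with
  | _ j ih =>
    rcases lt_or_ge j (m + d) with hj | hj
    · exact ⟨j, hj, rfl⟩
    · have := ih (j - d) (by omega)
      rwa [h (j - d) (by omega), Nat.sub_add_cancel (by omega)] at this

theorem infinite_range_of_eq_inv_pow {p : ℕ} (hp : p.Prime) {a : ℕ → ℝ} {n k : ℕ → ℕ}
    (hk : StrictMono k) (hnk : ∀ i, a (n i) = (p : ℝ)⁻¹ ^ k i) : (Set.range a).Infinite := by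
  have hP : (1 : ℝ) < p := by exact_mod_cast hp.one_lt
  have hinj : Function.Injective fun i => a (n i) := by
    simp only [hnk]
    exact (pow_right_injective₀ (by positivity) (inv_lt_one_of_one_lt₀ hP).ne).comp hk.injective
  exact (Set.infinite_range_of_injective hinj).mono (Set.range_comp_subset_range n a)

theorem one_le_norm_deriv_iterate_Pfam_one {K : Type*} [NontriviallyNormedField K]
    [IsUltrametricDist K] {p : ℕ} (hp : p.Prime) (hpnorm : ‖(p : K)‖ = (p : ℝ)⁻¹) {l : K}
    (hl : ‖l - 1‖ < 1) (n : ℕ) : 1 ≤ ‖deriv (Pfam p l)^[n] 1‖ := by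
  have hP : (1 : ℝ) < p := by exact_mod_cast hp.one_lt
  have hpK : (p : K) ≠ 0 := by
    rw [← norm_ne_zero_iff, hpnorm]
    positivity
  have h := norm_one_sub_div_natCast hp hpnorm hl
  have hlt : ‖(p : K)‖ < ‖1 - l / (p : K)‖ := by
    rw [h, hpnorm]
    exact (inv_lt_one_of_one_lt₀ hP).trans hP
  rw [((hasDerivAt_Pfam_one hpK l).iterate _ (Pfam_one l) n).deriv, norm_pow, add_sub_assoc,
    add_comm, norm_add_eq_left_of_norm_lt hlt, h]
  exact one_le_pow₀ hP.le

/-- **Benedetto's theorem.** For a dense set of parameters `λ ∈ Λ = {|λ − 1| < 1}`, the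
polynomial `P_λ` has a wandering disc contained in its filled Julia set which is not
attracted to an attracting cycle.  Here `K` plays the role of `ℂ_p`: a complete
algebraically closed ultrametric extension of `ℚ_p` with `‖p‖ = 1/p`. -/
theorem statement0 (p : ℕ) (hp : p.Prime)
    {K : Type*} [NontriviallyNormedField K] [IsAlgClosed K] [CompleteSpace K]
    [IsUltrametricDist K] [CharZero K]
    (hpnorm : ‖(p : K)‖ = (p : ℝ)⁻¹)
    (lam₀ : K) (hlam₀ : ‖lam₀ - 1‖ < 1) (ε : ℝ) (hε : 0 < ε) :
    ∃ lam : K, ‖lam - 1‖ < 1 ∧ ‖lam - lam₀‖ ≤ ε ∧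
      ∃ (c : K) (r : ℝ), 0 < r ∧
        -- (1) the closed ball `D = closedBall c r` is contained in the filled Julia set
        (∀ z ∈ closedBall c r, ∃ C : ℝ, ∀ n : ℕ, ‖(Pfam p lam)^[n] z‖ ≤ C) ∧
        -- (2) the iterated images of `D` are pairwise disjoint
        (∀ m n : ℕ, m ≠ n →
          ((Pfam p lam)^[m] '' closedBall c r) ∩ ((Pfam p lam)^[n] '' closedBall c r) = ∅) ∧
        -- (3) `D` is not attracted to any attracting cycle
        (∀ k : ℕ, 1 ≤ k → ∀ z₀ : K, (Pfam p lam)^[k] z₀ = z₀ →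
          ‖deriv ((Pfam p lam)^[k]) z₀‖ < 1 →
          ∀ x ∈ closedBall c r,
            ¬ Tendsto (fun n : ℕ => ⨅ j : Fin k, ‖(Pfam p lam)^[n] x - (Pfam p lam)^[(j : ℕ)] z₀‖)
              atTop (nhds 0)) := by
  obtain ⟨l, hl, hε', x, s, a, hs, ha₁, ha, n, k, hn, hk, hnk⟩ :=
    exists_norm_iterate_Pfam_sub_one_eq hp hpnorm hlam₀ hε
  have hP : (1 : ℝ) < p := by exact_mod_cast hp.one_lt
  refine ⟨l, hl, hε', x, s, hs, fun z hz => ⟨1, fun j => ?_⟩, ?_, ?_⟩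
  · have := IsUltrametricDist.norm_add_le_max ((Pfam p l)^[j] z - 1) 1
    rw [sub_add_cancel, ha j z hz, norm_one] at this
    exact this.trans (max_le (ha₁ j) le_rfl)
  · have key {m m' : ℕ} (h : m < m') :
        (Pfam p l)^[m] '' closedBall x s ∩ (Pfam p l)^[m'] '' closedBall x s = ∅ := by
      by_contra hne
      obtain ⟨y, ⟨z, hz, rfl⟩, z', hz', hzz'⟩ := Set.nonempty_iff_ne_empty.2 hne
      refine (infinite_range_of_eq_inv_pow hp hk hnk)
        (finite_range_of_eq_add (Nat.sub_pos_of_lt h) (m := m) fun j hj => ?_)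
      obtain ⟨i, rfl⟩ := Nat.exists_eq_add_of_le' hj
      rw [← ha _ z hz, ← ha _ z' hz', show i + m + (m' - m) = i + m' by omega,
        Function.iterate_add_apply _ i m, Function.iterate_add_apply _ i m', hzz']
    intro m m' hmm'
    rcases hmm'.lt_or_gt with h | h
    · exact key h
    · rw [Set.inter_comm]
      exact key h
  · intro N hN z₀ hz₀ hderiv z hz htend
    have : Nonempty (Fin N) := ⟨⟨0, hN⟩⟩
    have hz₀1 : z₀ ≠ 1 := by
      rintro rfl
      exact hderiv.not_ge (one_le_norm_deriv_iterate_Pfam_one hp hpnorm hl N)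
    have hw (j : Fin N) : 0 < ‖1 - (Pfam p l)^[(j : ℕ)] z₀‖ := by
      rw [norm_pos_iff, sub_ne_zero]
      intro hj
      apply hz₀1
      rw [← hz₀, ← Nat.sub_add_cancel j.2.le, Function.iterate_add_apply, ← hj,
        Function.iterate_fixed (Pfam_one l)]
    obtain ⟨j₀, hj₀⟩ := Finite.exists_min fun j : Fin N => ‖1 - (Pfam p l)^[(j : ℕ)] z₀‖
    have hto := (tendsto_pow_atTop_nhds_zero_of_lt_one (by positivity)
      (inv_lt_one_of_one_lt₀ hP)).comp hk.tendsto_atTop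
    obtain ⟨i, hi₁, hi₂⟩ := ((hto.eventually_lt_const (hw j₀)).and
      ((htend.comp hn.tendsto_atTop).eventually_lt_const (hw j₀))).exists
    refine hi₂.not_ge (le_ciInf fun j => (hj₀ j).trans_eq (norm_eq_of_norm_sub_lt ?_).symm)
    rw [sub_sub_sub_cancel_right, ha _ z hz, hnk]
    exact hi₁.trans_le (hj₀ j)
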